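/- Let I = (0,a), 0 < a ≤ ∞, φ an Orlicz function, w a decreasing non-negative weight function on I, and M(f) = ∫_I φ(f*/w) w. Then: (1) M is disjointly superadditive, i.e. M(f+g) ≥ M(f) + M(g) whenever f, g are measurable functions on I with disjoint supports; (2) if φ is p-concave for some 1 < p < ∞ (i.e. t ↦ φ(t^{1/p}) is concave on ℝ₊), then the modular M is p-concave, i.e. the map f ↦ M(f^{1/p}) is concave on the cone of non-negative measurable functions on I. -/

import Mathlib

open MeasureTheory Set Filter Topology ENNReal

noncomputable section

namespace OrliczRearrangement

/-- An Orlicz function: convex on `[0,∞)`, strictly increasing on `[0,∞)` and vanishing at `0`. -/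
def IsOrliczFn (φ : ℝ → ℝ) : Prop :=
  ConvexOn ℝ (Set.Ici 0) φ ∧ StrictMonoOn φ (Set.Ici 0) ∧ φ 0 = 0

/-- An `N`-function: an Orlicz function with `φ(t)/t → 0` as `t → 0⁺` and `φ(t)/t → ∞`
as `t → ∞`. -/
def IsNFn (φ : ℝ → ℝ) : Prop :=
  IsOrliczFn φ ∧ Filter.Tendsto (fun t => φ t / t) (nhdsWithin 0 (Set.Ioi 0)) (nhds 0) ∧
    Filter.Tendsto (fun t => φ t / t) Filter.atTop Filter.atTop

/-- The complementary (conjugate) function `φ*(t) = sup_{s>0} (st - φ(s))`. -/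
def conjFn (φ : ℝ → ℝ) (t : ℝ) : ℝ := sSup ((fun s => s * t - φ s) '' Set.Ioi 0)

/-- The interval `I = (0,a)`, `0 < a ≤ ∞`, as a subset of `ℝ`. -/
def Ioa' (a : ℝ≥0∞) : Set ℝ := {t : ℝ | 0 < t ∧ ENNReal.ofReal t < a}

/-- Distribution function `d_f(s) = |{t ∈ (0,a) : |f(t)| > s}|`. -/
def distr (a : ℝ≥0∞) (f : ℝ → ℝ) (s : ℝ) : ℝ≥0∞ := volume {t ∈ Ioa' a | s < |f t|}

/-- Decreasing rearrangement `f*(t) = inf{s ≥ 0 : d_f(s) ≤ t}` of `f` on `(0,a)`,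
with value `∞` when no such `s` exists. -/
def decRe (a : ℝ≥0∞) (f : ℝ → ℝ) (t : ℝ) : ℝ≥0∞ :=
  sInf (ENNReal.ofReal '' {s : ℝ | 0 ≤ s ∧ distr a f s ≤ ENNReal.ofReal t})

/-- Distribution of a sequence: `d_x(s) = |{k : |x(k)| > s}|`. -/
def sdistr (x : ℕ → ℝ) (s : ℝ) : ℕ∞ := {k : ℕ | s < |x k|}.encard

/-- Decreasing rearrangement of a sequence (`0`-indexed):
`x*(n) = inf{s > 0 : d_x(s) ≤ n}`, with value `∞` when no such `s` exists. -/
def sdecRe (x : ℕ → ℝ) (n : ℕ) : ℝ≥0∞ :=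
  sInf (ENNReal.ofReal '' {s : ℝ | 0 < s ∧ sdistr x s ≤ (n : ℕ∞)})

/-- The extended-real quantity `φ(c/v)·v`, with the convention that for `v = 0` it equals
`0` if `c = 0` and `∞` if `c ≠ 0`. -/
def oterm (φ : ℝ → ℝ) (c v : ℝ) : ℝ≥0∞ :=
  if v = 0 then (if c = 0 then 0 else ∞) else ENNReal.ofReal (φ (c / v) * v)

/-- The quantity `φ(c/v)·v` for an extended-real numerator `c`; it equals `∞` when
`c = ∞`. -/
def otermE (φ : ℝ → ℝ) (c : ℝ≥0∞) (v : ℝ) : ℝ≥0∞ :=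
  if c = ∞ then ∞ else oterm φ c.toReal v

/-- The modular `M(f) = ∫_I φ(f*/w)·w`. -/
def Mmod (a : ℝ≥0∞) (φ w f : ℝ → ℝ) : ℝ≥0∞ :=
  ∫⁻ t in Ioa' a, otermE φ (decRe a f t) (w t)

/-- The functional `‖f‖_M = inf{ε > 0 : M(f/ε) ≤ 1}` (equal to `∞` if no such `ε`). -/
def Mnorm (a : ℝ≥0∞) (φ w f : ℝ → ℝ) : ℝ≥0∞ :=
  ⨅ ε ∈ {ε : ℝ | 0 < ε ∧ Mmod a φ w (fun t => f t / ε) ≤ 1}, ENNReal.ofReal ε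

/-- The class `M_{φ,w}` of measurable `f` with `M(λf) < ∞` for some `λ > 0`. -/
def Mclass (a : ℝ≥0∞) (φ w : ℝ → ℝ) : Set (ℝ → ℝ) :=
  {f | Measurable f ∧ ∃ c > 0, Mmod a φ w (fun t => c * f t) < ∞}

/-- Submajorization `v ≺ w` on `(0,a)`: `∫₀ᵗ v* ≤ ∫₀ᵗ w*` for all `t ∈ (0,a)`. -/
def Submaj (a : ℝ≥0∞) (v w : ℝ → ℝ) : Prop :=
  ∀ t ∈ Ioa' a, ∫⁻ s in Set.Ioo 0 t, decRe a v s ≤ ∫⁻ s in Set.Ioo 0 t, decRe a w s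

/-- The modular `P`, for (decreasing-rearrangement-like) `[0,∞]`-valued data `F`:
`P(F) = inf{∫_I φ(F/v)·v : v ≥ 0, v ≺ w}`. -/
def PmodE (a : ℝ≥0∞) (φ w : ℝ → ℝ) (F : ℝ → ℝ≥0∞) : ℝ≥0∞ :=
  ⨅ v ∈ {v : ℝ → ℝ | Measurable v ∧ (∀ t, 0 ≤ v t) ∧ Submaj a v w},
    ∫⁻ t in Ioa' a, otermE φ (F t) (v t)

/-- The modular `P(f) = inf{∫_I φ(|f|/v)·v : v ≥ 0, v ≺ w}`. -/
def Pmod (a : ℝ≥0∞) (φ w f : ℝ → ℝ) : ℝ≥0∞ :=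
  PmodE a φ w fun t => ENNReal.ofReal |f t|

/-- The norm of `𝓜_{φ,w}` for `[0,∞]`-valued data. -/
def PnormE (a : ℝ≥0∞) (φ w : ℝ → ℝ) (F : ℝ → ℝ≥0∞) : ℝ≥0∞ :=
  ⨅ ε ∈ {ε : ℝ | 0 < ε ∧ PmodE a φ w (fun t => F t / ENNReal.ofReal ε) ≤ 1},
    ENNReal.ofReal ε

/-- The norm `‖f‖_𝓜 = inf{ε > 0 : P(f/ε) ≤ 1}`. -/
def Pnorm (a : ℝ≥0∞) (φ w f : ℝ → ℝ) : ℝ≥0∞ :=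
  PnormE a φ w fun t => ENNReal.ofReal |f t|

/-- The space `𝓜_{φ,w}` of measurable `f` with `P(λf) < ∞` for some `λ > 0`. -/
def Pclass (a : ℝ≥0∞) (φ w : ℝ → ℝ) : Set (ℝ → ℝ) :=
  {f | Measurable f ∧ ∃ c > 0, Pmod a φ w (fun t => c * f t) < ∞}

/-- Sequence submajorization `v ≺ w`. -/
def sSubmaj (v w : ℕ → ℝ) : Prop :=
  ∀ m : ℕ, ∑ n ∈ Finset.range m, sdecRe v n ≤ ∑ n ∈ Finset.range m, sdecRe w n

/-- Sequence modular `p` for `[0,∞]`-valued data. -/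
def spmodE (φ : ℝ → ℝ) (w : ℕ → ℝ) (X : ℕ → ℝ≥0∞) : ℝ≥0∞ :=
  ⨅ v ∈ {v : ℕ → ℝ | (∀ n, 0 ≤ v n) ∧ sSubmaj v w}, ∑' n, otermE φ (X n) (v n)

/-- Sequence modular `p(x) = inf{∑ φ(|x(n)|/v(n))·v(n) : v ≥ 0, v ≺ w}`. -/
def spmod (φ : ℝ → ℝ) (w x : ℕ → ℝ) : ℝ≥0∞ :=
  spmodE φ w fun n => ENNReal.ofReal |x n|

/-- Sequence norm for `[0,∞]`-valued data. -/
def spnormE (φ : ℝ → ℝ) (w : ℕ → ℝ) (X : ℕ → ℝ≥0∞) : ℝ≥0∞ :=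
  ⨅ ε ∈ {ε : ℝ | 0 < ε ∧ spmodE φ w (fun n => X n / ENNReal.ofReal ε) ≤ 1},
    ENNReal.ofReal ε

/-- Sequence norm `‖x‖_𝔪 = inf{ε > 0 : p(x/ε) ≤ 1}`. -/
def spnorm (φ : ℝ → ℝ) (w x : ℕ → ℝ) : ℝ≥0∞ :=
  spnormE φ w fun n => ENNReal.ofReal |x n|

/-- Dilation operator `D₂f(t) = f(t/2)`, where `f` is extended by `0` outside `(0,a)`. -/
def D2 (a : ℝ≥0∞) (f : ℝ → ℝ) : ℝ → ℝ := fun t => (Ioa' a).indicator f (t / 2)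

/-- A measure preserving transformation from `S` onto `S`. -/
def MeasPresOn (σ : ℝ → ℝ) (S : Set ℝ) : Prop :=
  Set.MapsTo σ S S ∧ Set.SurjOn σ S S ∧ Measurable σ ∧
    ∀ A : Set ℝ, A ⊆ S → MeasurableSet A → volume (S ∩ σ ⁻¹' A) = volume A

/-- Luxemburg norm of the weighted Orlicz space `L_φ(w)` on `(0,a)`. -/
def luxNorm (a : ℝ≥0∞) (φ w g : ℝ → ℝ) : ℝ≥0∞ :=
  ⨅ ε ∈ {ε : ℝ | 0 < ε ∧
      ∫⁻ t in Ioa' a, ENNReal.ofReal (φ (|g t| / ε) * w t) ≤ 1}, ENNReal.ofReal ε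

/-- The Orlicz norm of `f` in `Λ_{φ*,w}`, defined by duality with the unit ball of
`L_φ(w)`: `‖f‖⁰ = sup{∫_I f° g w : g ≥ 0, ‖g‖_{L_φ(w)} ≤ 1}`. -/
def lamOnorm (a : ℝ≥0∞) (φ w f : ℝ → ℝ) : ℝ≥0∞ :=
  ⨆ g ∈ {g : ℝ → ℝ | Measurable g ∧ (∀ t, 0 ≤ g t) ∧ luxNorm a φ w g ≤ 1},
    ∫⁻ t in Ioa' a, decRe a f t * ENNReal.ofReal (g t * w t)

/-- The Orlicz–Lorentz class `Λ_{φs,w}`: measurable `g` whose (finite) decreasing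
rearrangement satisfies `∫_I φs(c·g°)·w < ∞` for some `c > 0`. -/
def LamClass (a : ℝ≥0∞) (φs w : ℝ → ℝ) : Set (ℝ → ℝ) :=
  {g | Measurable g ∧ (∀ t ∈ Ioa' a, decRe a g t < ∞) ∧
    ∃ c > 0, ∫⁻ t in Ioa' a, ENNReal.ofReal (φs (c * (decRe a g t).toReal) * w t) < ∞}

/-- The (generalized right-continuous) inverse `φ⁻¹(y) = inf{s ≥ 0 : φ(s) ≥ y}`. -/
def phiInv (φ : ℝ → ℝ) (y : ℝ) : ℝ := sInf {s : ℝ | 0 ≤ s ∧ y ≤ φ s}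

lemma measurableSet_Ioa' (a : ℝ≥0∞) : MeasurableSet (Ioa' a) :=
  measurableSet_Ioi.inter (measurableSet_lt ENNReal.measurable_ofReal measurable_const)

lemma Ioa'_top : Ioa' ∞ = Ioi 0 := by
  ext t; simp [Ioa']

lemma Ioa'_ofReal (c : ℝ) : Ioa' (ENNReal.ofReal c) = Ioo 0 c := by
  ext t
  simp only [Ioa', mem_ofPred_eq, mem_Ioo]
  exact and_congr_right fun ht => ENNReal.ofReal_lt_ofReal_iff_of_nonneg ht.le

lemma Ioa'_mono {c d : ℝ≥0∞} (h : c ≤ d) : Ioa' c ⊆ Ioa' d :=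
  fun _ ht => ⟨ht.1, ht.2.trans_le h⟩

lemma volume_Ioa' (c : ℝ≥0∞) : volume (Ioa' c) = c := by
  induction c using ENNReal.recTopCoe with
  | top => simp [Ioa'_top]
  | coe c =>
    rw [← ENNReal.ofReal_coe_nnreal, Ioa'_ofReal]
    simp

lemma distr_le (a : ℝ≥0∞) (f : ℝ → ℝ) (s : ℝ) : distr a f s ≤ a :=
  (measure_mono fun _ ht => ht.1).trans_eq (volume_Ioa' a)

lemma distr_anti (a : ℝ≥0∞) (f : ℝ → ℝ) : Antitone (distr a f) :=
  fun _ _ h => measure_mono fun _ ht => ⟨ht.1, h.trans_lt ht.2⟩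

lemma decRe_le_iff {a : ℝ≥0∞} {f : ℝ → ℝ} {s t : ℝ} (hs : 0 ≤ s) :
    decRe a f t ≤ ENNReal.ofReal s ↔ distr a f s ≤ ENNReal.ofReal t := by
  refine ⟨fun h => ?_, fun h => sInf_le ⟨s, ⟨hs, h⟩, rfl⟩⟩
  have hlt : ∀ s', s < s' → distr a f s' ≤ ENNReal.ofReal t := by
    intro s' hs'
    have h1 : decRe a f t < ENNReal.ofReal s' :=
      h.trans_lt ((ENNReal.ofReal_lt_ofReal_iff (hs.trans_lt hs')).2 hs')
    obtain ⟨_, ⟨u, ⟨_, hu⟩, rfl⟩, hus⟩ := sInf_lt_iff.1 h1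
    exact (distr_anti a f ((ENNReal.ofReal_lt_ofReal_iff (hs.trans_lt hs')).1 hus).le).trans hu
  have hmono : Monotone fun n : ℕ => {x ∈ Ioa' a | s + 1 / ((n : ℝ) + 1) < |f x|} := by
    intro m n hmn x hx
    refine ⟨hx.1, lt_of_le_of_lt ?_ hx.2⟩
    gcongr
  have hU : {x ∈ Ioa' a | s < |f x|} = ⋃ n : ℕ, {x ∈ Ioa' a | s + 1 / ((n : ℝ) + 1) < |f x|} := by
    ext x
    simp only [mem_ofPred_eq, mem_iUnion]
    refine ⟨fun hx => ?_, fun ⟨n, hn⟩ => ⟨hn.1, lt_trans ?_ hn.2⟩⟩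
    · obtain ⟨n, hn⟩ := exists_nat_one_div_lt (sub_pos.2 hx.2)
      exact ⟨n, hx.1, by linarith⟩
    · linarith [Nat.one_div_pos_of_nat (α := ℝ) (n := n)]
  rw [distr, hU, hmono.measure_iUnion]
  exact iSup_le fun n => hlt _ (by linarith [Nat.one_div_pos_of_nat (α := ℝ) (n := n)])

lemma ofReal_lt_decRe_iff {a : ℝ≥0∞} {f : ℝ → ℝ} {s t : ℝ} (hs : 0 ≤ s) :
    ENNReal.ofReal s < decRe a f t ↔ ENNReal.ofReal t < distr a f s := by
  rw [← not_le, decRe_le_iff hs, not_le]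

lemma decRe_anti (a : ℝ≥0∞) (f : ℝ → ℝ) : Antitone (decRe a f) :=
  fun _ _ h => sInf_le_sInf (image_mono fun _ hs => ⟨hs.1, hs.2.trans (ENNReal.ofReal_le_ofReal h)⟩)

/-- Layer cake formula on the half line, for a product of two layers. -/
lemma setLIntegral_Ioa'_swap (S : Set ℝ) (F : ℝ → ℝ≥0∞)
    (hF : Measurable F) (k : ℝ → ℝ → ℝ≥0∞) (hk : Measurable (Function.uncurry k)) :
    ∫⁻ t in S, ∫⁻ s in Ioa' (F t), k s t =
      ∫⁻ s in Ioi (0 : ℝ), ∫⁻ t in S ∩ {t | ENNReal.ofReal s < F t}, k s t := by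
  have hE : MeasurableSet {q : ℝ × ℝ | ENNReal.ofReal q.2 < F q.1} :=
    measurableSet_lt (ENNReal.measurable_ofReal.comp measurable_snd) (hF.comp measurable_fst)
  have h1 : ∀ t, ∫⁻ s in Ioa' (F t), k s t = ∫⁻ s in Ioi (0 : ℝ),
      {q : ℝ × ℝ | ENNReal.ofReal q.2 < F q.1}.indicator (fun q => k q.2 q.1) (t, s) := by
    intro t
    have : Ioa' (F t) = {s | ENNReal.ofReal s < F t} ∩ Ioi 0 := by
      ext s; simp [Ioa', and_comm]
    rw [this, ← Measure.restrict_restrict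
      (measurableSet_lt ENNReal.measurable_ofReal measurable_const), ← lintegral_indicator
      (measurableSet_lt ENNReal.measurable_ofReal measurable_const)]
    rfl
  have h2 : ∀ s, ∫⁻ t in S ∩ {t | ENNReal.ofReal s < F t}, k s t = ∫⁻ t in S,
      {q : ℝ × ℝ | ENNReal.ofReal q.2 < F q.1}.indicator (fun q => k q.2 q.1) (t, s) := by
    intro s
    rw [inter_comm, ← Measure.restrict_restrict (measurableSet_lt measurable_const hF),
      ← lintegral_indicator (measurableSet_lt measurable_const hF)]
    rfl
  simp_rw [h1, h2]
  refine lintegral_lintegral_swap ?_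
  exact ((hk.comp measurable_swap).indicator hE).aemeasurable

/-- The right derivative of `φ`, extended by `0` to the nonpositive half line. -/
def rDeriv (φ : ℝ → ℝ) (x : ℝ) : ℝ := if 0 < x then derivWithin φ (Ioi x) x else 0

section Orlicz

variable {φ : ℝ → ℝ}

lemma IsOrliczFn.pos (hφ : IsOrliczFn φ) {x : ℝ} (hx : 0 < x) : 0 < φ x := by
  simpa [hφ.2.2] using hφ.2.1 (mem_Ici.2 le_rfl) (mem_Ici.2 hx.le) hx

lemma IsOrliczFn.nonneg (hφ : IsOrliczFn φ) {x : ℝ} (hx : 0 ≤ x) : 0 ≤ φ x := by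
  rcases hx.eq_or_lt with rfl | h
  · exact hφ.2.2.ge
  · exact (hφ.pos h).le

lemma IsOrliczFn.continuousOn (hφ : IsOrliczFn φ) : ContinuousOn φ (Ici 0) := by
  intro x hx
  rcases (mem_Ici.1 hx).eq_or_lt with rfl | h
  · have h1 : Tendsto (fun y => y * φ 1) (𝓝[Ici 0] 0) (𝓝 0) := by
      have : Continuous fun y : ℝ => y * φ 1 := by fun_prop
      simpa using (this.tendsto 0).mono_left nhdsWithin_le_nhds
    rw [ContinuousWithinAt, hφ.2.2]
    refine tendsto_of_tendsto_of_tendsto_of_le_of_le' tendsto_const_nhds h1 ?_ ?_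
    · exact eventually_mem_nhdsWithin.mono fun y hy => hφ.nonneg hy
    · have : ∀ᶠ y in 𝓝[Ici (0:ℝ)] 0, y ≤ 1 :=
        nhdsWithin_le_nhds (eventually_le_nhds zero_lt_one)
      filter_upwards [this, eventually_mem_nhdsWithin] with y hy1 hy0
      have := hφ.1.2 (mem_Ici.2 (zero_le_one' ℝ)) (mem_Ici.2 (le_refl (0:ℝ))) hy0
        (sub_nonneg.2 hy1) (by ring)
      simpa [hφ.2.2] using this
  · have := hφ.1.continuousOn_interior
    rw [interior_Ici] at this
    exact (this.continuousAt (Ioi_mem_nhds h)).continuousWithinAt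

lemma IsOrliczFn.hasDerivWithinAt (hφ : IsOrliczFn φ) {x : ℝ} (hx : 0 < x) :
    HasDerivWithinAt φ (rDeriv φ x) (Ioi x) x := by
  rw [rDeriv, if_pos hx]
  exact hφ.1.hasDerivWithinAt_rightDeriv_of_mem_interior (by simpa using hx)

lemma IsOrliczFn.monotone_rDeriv (hφ : IsOrliczFn φ) : Monotone (rDeriv φ) := by
  intro x y hxy
  by_cases hx : 0 < x
  · have hy := hx.trans_le hxy
    simp only [rDeriv, hx, hy, if_true]
    exact hφ.1.monotoneOn_rightDeriv (by simpa using hx) (by simpa using hy) hxy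
  · rw [rDeriv, if_neg hx]
    unfold rDeriv
    split_ifs with hy
    · rw [hφ.1.rightDeriv_eq_sInf_slope_of_mem_interior (by simpa using hy)]
      refine Real.sInf_nonneg ?_
      rintro _ ⟨z, ⟨hz, hyz⟩, rfl⟩
      rw [slope_def_field]
      exact div_nonneg (sub_nonneg.2 (hφ.2.1.monotoneOn hy.le hz hyz.le)) (sub_nonneg.2 hyz.le)
    · exact le_rfl

lemma IsOrliczFn.rDeriv_nonneg (hφ : IsOrliczFn φ) (x : ℝ) : 0 ≤ rDeriv φ x := by
  rcases le_total x 0 with h | h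
  · simp [rDeriv, h.not_gt]
  · simpa [rDeriv] using hφ.monotone_rDeriv h

lemma IsOrliczFn.linear_le (hφ : IsOrliczFn φ) {x : ℝ} (hx : 1 ≤ x) : x * φ 1 ≤ φ x := by
  have h0 : 0 < x := by linarith
  have := hφ.1.2 (mem_Ici.2 h0.le) (mem_Ici.2 (le_refl (0:ℝ))) (inv_nonneg.2 h0.le)
    (sub_nonneg.2 (inv_le_one_of_one_le₀ hx)) (by ring)
  simp only [smul_eq_mul, mul_zero, add_zero, hφ.2.2, inv_mul_cancel₀ h0.ne'] at this
  rwa [← div_eq_inv_mul, le_div_iff₀ h0, mul_comm] at this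

/-- Fundamental theorem of calculus for the perspective `c ↦ φ(c/v)·v`. -/
lemma IsOrliczFn.lintegral_rDeriv_ofReal (hφ : IsOrliczFn φ) {v c : ℝ} (hv : 0 < v) (hc : 0 ≤ c) :
    ∫⁻ s in Ioa' (ENNReal.ofReal c), ENNReal.ofReal (rDeriv φ (s / v)) =
      ENNReal.ofReal (φ (c / v) * v) := by
  have hcont : ContinuousOn (fun s => φ (s / v) * v) (Icc 0 c) := by
    refine ContinuousOn.mul (hφ.continuousOn.comp (by fun_prop) ?_) continuousOn_const
    exact fun s hs => div_nonneg hs.1 hv.le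
  have hderiv : ∀ s ∈ Ioo 0 c,
      HasDerivWithinAt (fun s => φ (s / v) * v) (rDeriv φ (s / v)) (Ioi s) s := by
    intro s hs
    have h1 := (hφ.hasDerivWithinAt (div_pos hs.1 hv)).comp s
      (((hasDerivAt_id s).div_const v).hasDerivWithinAt (s := Ioi s))
      (fun y hy => div_lt_div_of_pos_right hy hv)
    have h2 := h1.mul_const v
    have h3 : rDeriv φ (s / v) * (1 / v) * v = rDeriv φ (s / v) := by field_simp
    rw [h3] at h2
    exact h2
  have hint : IntegrableOn (fun s => rDeriv φ (s / v)) (Ioc 0 c) :=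
    intervalIntegral.integrableOn_deriv_right_of_nonneg hcont hderiv
      fun s _ => hφ.rDeriv_nonneg _
  have := intervalIntegral.integral_eq_sub_of_hasDeriv_right_of_le hc hcont hderiv
    ((intervalIntegrable_iff_integrableOn_Ioc_of_le hc).2 hint)
  rw [intervalIntegral.integral_of_le hc, zero_div, hφ.2.2, zero_mul, sub_zero] at this
  rw [Ioa'_ofReal, ← this, ofReal_integral_eq_lintegral_ofReal hint
    (ae_of_all _ fun s => hφ.rDeriv_nonneg _)]
  exact setLIntegral_congr Ioo_ae_eq_Ioc

/-- The density of `c ↦ otermE φ c v`. -/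
def kern (φ : ℝ → ℝ) (s v : ℝ) : ℝ≥0∞ :=
  if v = 0 then ∞ else ENNReal.ofReal (rDeriv φ (s / v))

lemma IsOrliczFn.measurable_kern (hφ : IsOrliczFn φ) :
    Measurable (Function.uncurry (kern φ)) := by
  refine Measurable.ite (measurableSet_eq_fun measurable_snd measurable_const)
    measurable_const ?_
  exact (hφ.monotone_rDeriv.measurable.comp (measurable_fst.div measurable_snd)).ennreal_ofReal

lemma IsOrliczFn.kern_anti (hφ : IsOrliczFn φ) {s v v' : ℝ} (hs : 0 ≤ s) (hv : 0 ≤ v)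
    (h : v ≤ v') : kern φ s v' ≤ kern φ s v := by
  unfold kern
  rcases hv.eq_or_lt with rfl | hv
  · simp
  · rw [if_neg hv.ne', if_neg (hv.trans_le h).ne']
    exact ENNReal.ofReal_le_ofReal (hφ.monotone_rDeriv (by gcongr))

lemma IsOrliczFn.lintegral_kern (hφ : IsOrliczFn φ) (c : ℝ≥0∞) {v : ℝ} (hv : 0 ≤ v) :
    ∫⁻ s in Ioa' c, kern φ s v = otermE φ c v := by
  rcases hv.eq_or_lt with rfl | hv
  · simp only [kern, if_true, lintegral_const, Measure.restrict_apply_univ, volume_Ioa']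
    by_cases h0 : c = 0
    · simp [otermE, oterm, h0]
    · by_cases h1 : c = ∞
      · simp [otermE, h1]
      · simp [otermE, oterm, h0, h1, ENNReal.toReal_eq_zero_iff]
  · simp only [kern, hv.ne', if_false]
    by_cases h1 : c = ∞
    · subst h1
      simp only [otermE, if_true]
      rw [eq_top_iff]
      refine ENNReal.le_of_forall_nnreal_lt fun r _ => ?_
      have h2 : (1:ℝ) ≤ 1 + r / (v * φ 1) := by
        have := (hφ.pos one_pos).le
        have : 0 ≤ (r:ℝ) / (v * φ 1) := by positivity
        linarith
      have h3 := hφ.lintegral_rDeriv_ofReal hv (c := (1 + r / (v * φ 1)) * v) (by positivity)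
      rw [mul_div_cancel_right₀ _ hv.ne'] at h3
      calc (r : ℝ≥0∞) = ENNReal.ofReal r := by simp
        _ ≤ ENNReal.ofReal (φ (1 + r / (v * φ 1)) * v) := by
          refine ENNReal.ofReal_le_ofReal ?_
          have h4 := hφ.linear_le h2
          have h5 := hφ.pos one_pos
          calc (r:ℝ) ≤ (1 + r / (v * φ 1)) * φ 1 * v := by
                field_simp; nlinarith [mul_pos h5 hv]
            _ ≤ _ := by gcongr
        _ ≤ _ := by rw [← h3]; exact lintegral_mono_set (Ioa'_mono le_top)
    · rw [otermE, if_neg h1, oterm, if_neg hv.ne',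
        ← hφ.lintegral_rDeriv_ofReal hv ENNReal.toReal_nonneg, ENNReal.ofReal_toReal h1]

end Orlicz

lemma lintegral_Ioa'_ofReal_add_le {a : ℝ≥0∞} {F : ℝ → ℝ≥0∞} (hF : MonotoneOn F (Ioa' a))
    {c : ℝ} (hc : 0 ≤ c) {d : ℝ≥0∞} (hcd : ENNReal.ofReal c + d ≤ a) :
    (∫⁻ t in Ioa' (ENNReal.ofReal c), F t) + ∫⁻ t in Ioa' d, F t ≤
      ∫⁻ t in Ioa' (ENNReal.ofReal c + d), F t := by
  have hadd : ∀ t : ℝ, t ∈ Ioa' d → t + c ∈ Ioa' (ENNReal.ofReal c + d) := by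
    intro t ht
    refine ⟨by linarith [ht.1], ?_⟩
    rw [ENNReal.ofReal_add ht.1.le hc, add_comm]
    exact (ENNReal.add_lt_add_iff_left ENNReal.ofReal_ne_top).2 ht.2
  set S : Set ℝ := (fun t => t - c) ⁻¹' Ioa' d with hS
  have hSm : MeasurableSet S := (measurable_id.sub_const c) (measurableSet_Ioa' d)
  have h1 : ∫⁻ t in Ioa' d, F t ≤ ∫⁻ t in S, F t := by
    rw [← lintegral_indicator hSm, ← lintegral_add_right_eq_self (S.indicator F) c,
      ← lintegral_indicator (measurableSet_Ioa' d)]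
    refine lintegral_mono fun t => ?_
    by_cases ht : t ∈ Ioa' d
    · have : t + c ∈ S := by simpa [hS] using ht
      rw [indicator_of_mem ht, indicator_of_mem this]
      refine hF ?_ (Ioa'_mono hcd (hadd t ht)) (by linarith)
      exact Ioa'_mono (le_add_self.trans hcd) ht
    · simp [indicator_of_notMem ht]
  have hdisj : Disjoint (Ioa' (ENNReal.ofReal c)) S := by
    rw [disjoint_left, Ioa'_ofReal]
    intro t ht hts
    have := hts.1
    linarith [ht.2]
  refine (add_le_add_right h1 _).trans ?_
  rw [← lintegral_union hSm hdisj]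
  refine lintegral_mono_set (union_subset (Ioa'_mono le_self_add) fun t ht => ?_)
  simpa using hadd _ ht

lemma lintegral_Ioa'_add_le {a : ℝ≥0∞} {F : ℝ → ℝ≥0∞} (hF : MonotoneOn F (Ioa' a))
    {c d : ℝ≥0∞} (hcd : c + d ≤ a) :
    (∫⁻ t in Ioa' c, F t) + ∫⁻ t in Ioa' d, F t ≤ ∫⁻ t in Ioa' (c + d), F t := by
  by_cases hc : c = ∞
  · by_cases hd : d = ∞
    · subst hc hd
      have ha : a = ∞ := by simpa using hcd
      subst ha
      rw [top_add]
      by_cases h0 : ∀ t ∈ Ioa' ∞, F t = 0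
      · have : ∫⁻ t in Ioa' ∞, F t = 0 := by
          rw [setLIntegral_congr_fun (measurableSet_Ioa' _) h0]; simp
        simp [this]
      · push Not at h0
        obtain ⟨t₀, ht₀, hne⟩ := h0
        have : ∫⁻ t in Ioa' ∞, F t = ∞ := by
          rw [eq_top_iff]
          have hsub : Ioi t₀ ⊆ Ioa' ∞ := by
            rw [Ioa'_top] at ht₀ ⊢
            exact Ioi_subset_Ioi (le_of_lt ht₀)
          calc ∞ = ∫⁻ _ in Ioi t₀, F t₀ := by simp [ENNReal.mul_top hne]
            _ ≤ ∫⁻ t in Ioi t₀, F t := setLIntegral_mono' measurableSet_Ioi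
                fun t ht => hF ht₀ (hsub ht) (le_of_lt ht)
            _ ≤ _ := lintegral_mono_set hsub
        simp [this]
    · rw [add_comm, add_comm c]
      simpa [ENNReal.ofReal_toReal hd] using
        lintegral_Ioa'_ofReal_add_le hF (c := d.toReal) (d := c) ENNReal.toReal_nonneg
          (by simpa [ENNReal.ofReal_toReal hd, add_comm] using hcd)
  · simpa [ENNReal.ofReal_toReal hc] using
      lintegral_Ioa'_ofReal_add_le hF (c := c.toReal) (d := d) ENNReal.toReal_nonneg
        (by simpa [ENNReal.ofReal_toReal hc] using hcd)

lemma IsOrliczFn.Mmod_eq {a : ℝ≥0∞} {φ w : ℝ → ℝ} (hφ : IsOrliczFn φ) (hw_meas : Measurable w)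
    (hw_nonneg : ∀ t ∈ Ioa' a, 0 ≤ w t) (f : ℝ → ℝ) :
    Mmod a φ w f = ∫⁻ s in Ioi (0 : ℝ), ∫⁻ t in Ioa' (distr a f s), kern φ s (w t) := by
  have h1 : Mmod a φ w f = ∫⁻ t in Ioa' a, ∫⁻ s in Ioa' (decRe a f t), kern φ s (w t) :=
    setLIntegral_congr_fun (measurableSet_Ioa' a)
      fun t ht => (hφ.lintegral_kern _ (hw_nonneg t ht)).symm
  rw [h1, setLIntegral_Ioa'_swap _ _ (decRe_anti a f).measurable
    (fun s t => kern φ s (w t))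
    (hφ.measurable_kern.comp (measurable_fst.prodMk (hw_meas.comp measurable_snd)))]
  refine setLIntegral_congr_fun measurableSet_Ioi fun s hs => ?_
  have : Ioa' a ∩ {t | ENNReal.ofReal s < decRe a f t} = Ioa' (distr a f s) := by
    ext t
    simp only [Ioa', mem_inter_iff, mem_ofPred_eq, ofReal_lt_decRe_iff (le_of_lt hs)]
    exact ⟨fun h => ⟨h.1.1, h.2⟩, fun h => ⟨⟨h.1, h.2.trans_le (distr_le a f s)⟩, h.2⟩⟩
  simp only [this]

lemma distr_add_of_disjoint {a : ℝ≥0∞} {f g : ℝ → ℝ} (hg : Measurable g)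
    (hfg : ∀ t ∈ Ioa' a, f t = 0 ∨ g t = 0) {s : ℝ} (hs : 0 ≤ s) :
    distr a (fun t => f t + g t) s = distr a f s + distr a g s := by
  have hgm : MeasurableSet {t ∈ Ioa' a | s < |g t|} :=
    (measurableSet_Ioa' a).inter (measurableSet_lt measurable_const hg.abs)
  rw [distr, distr, distr, ← measure_union _ hgm]
  · congr 1
    ext t
    simp only [mem_ofPred_eq, mem_union]
    rw [← and_or_left, and_congr_right_iff]
    intro ht
    rcases hfg t ht with h | h <;> simp [h, hs.not_gt]
  · rw [disjoint_left]
    rintro t ⟨ht, h1⟩ ⟨_, h2⟩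
    rcases hfg t ht with h | h
    · exact hs.not_gt (by simpa [h] using h1)
    · exact hs.not_gt (by simpa [h] using h2)

/-- The modular `M` is disjointly superadditive. -/
lemma IsOrliczFn.Mmod_add_le {a : ℝ≥0∞} {φ w : ℝ → ℝ} (hφ : IsOrliczFn φ)
    (hw_meas : Measurable w) (hw_nonneg : ∀ t ∈ Ioa' a, 0 ≤ w t)
    (hw_dec : ∀ s ∈ Ioa' a, ∀ t ∈ Ioa' a, s ≤ t → w t ≤ w s) {f g : ℝ → ℝ}
    (hg : Measurable g) (hfg : ∀ t ∈ Ioa' a, f t = 0 ∨ g t = 0) :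
    Mmod a φ w f + Mmod a φ w g ≤ Mmod a φ w (fun t => f t + g t) := by
  simp only [hφ.Mmod_eq hw_meas hw_nonneg]
  refine (le_lintegral_add _ _).trans (setLIntegral_mono' measurableSet_Ioi fun s hs => ?_)
  have hd := distr_add_of_disjoint hg hfg (le_of_lt hs)
  rw [hd]
  refine lintegral_Ioa'_add_le (fun t ht t' ht' htt' => ?_) (hd ▸ distr_le _ _ _)
  exact hφ.kern_anti (le_of_lt hs) (hw_nonneg _ ht') (hw_dec _ ht _ ht' htt')

section Kernel

variable {φ : ℝ → ℝ}

lemma IsOrliczFn.otermE_mono (hφ : IsOrliczFn φ) {c c' : ℝ≥0∞} {v v' : ℝ} (hv : 0 ≤ v)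
    (hc : c ≤ c') (h : v ≤ v') : otermE φ c v' ≤ otermE φ c' v := by
  rw [← hφ.lintegral_kern _ hv, ← hφ.lintegral_kern _ (hv.trans h)]
  refine (lintegral_mono_set (Ioa'_mono hc)).trans ?_
  exact setLIntegral_mono' (measurableSet_Ioa' _) fun s hs => hφ.kern_anti hs.1.le hv h

lemma IsOrliczFn.otermE_pos (hφ : IsOrliczFn φ) {c : ℝ≥0∞} {v : ℝ} (hv : 0 ≤ v) (hc : c ≠ 0) :
    otermE φ c v ≠ 0 := by
  by_cases h1 : c = ∞
  · simp [otermE, h1]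
  rcases hv.eq_or_lt with rfl | hv
  · simp [otermE, oterm, hc, h1, ENNReal.toReal_eq_zero_iff]
  · rw [otermE, if_neg h1, oterm, if_neg hv.ne']
    have := hφ.pos (div_pos (ENNReal.toReal_pos hc h1) hv)
    simpa using mul_pos this hv

lemma IsOrliczFn.perspective_sub_anti (hφ : IsOrliczFn φ) {v v' B C : ℝ} (hv : 0 < v)
    (h : v ≤ v') (hC : 0 ≤ C) (hCB : C < B) :
    φ (B / v') * v' - φ (C / v') * v' ≤ φ (B / v) * v - φ (C / v) * v := by
  have hv' := hv.trans_le h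
  have hB := hC.trans_lt hCB
  have h1 : C / v' < B / v' := by gcongr
  have h2 : C / v < B / v := by gcongr
  have h3 : B / v' ≤ B / v := by gcongr
  have h4 : C / v' ≤ C / v := by gcongr
  have m : ∀ {x y : ℝ}, 0 ≤ x → 0 < y → x / y ∈ Ici (0 : ℝ) := fun hx hy => div_nonneg hx hy.le
  have s1 := hφ.1.secant_mono (m hC hv') (m hB.le hv') (m hB.le hv) h1.ne' (h1.trans_le h3).ne' h3
  have s2 := hφ.1.secant_mono (m hB.le hv) (m hC hv') (m hC hv) (h1.trans_le h3).ne h2.ne h4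
  have e1 : (φ (C / v') - φ (B / v)) / (C / v' - B / v) =
      (φ (B / v) - φ (C / v')) / (B / v - C / v') := by
    rw [← neg_sub, ← neg_sub (B / v), neg_div_neg_eq]
  have e2 : (φ (C / v) - φ (B / v)) / (C / v - B / v) =
      (φ (B / v) - φ (C / v)) / (B / v - C / v) := by
    rw [← neg_sub, ← neg_sub (B / v), neg_div_neg_eq]
  rw [e1, e2] at s2
  have s3 := s1.trans s2
  rw [← sub_div, ← sub_div, div_div_eq_mul_div, div_div_eq_mul_div,
    div_le_div_iff_of_pos_right (sub_pos.2 hCB)] at s3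
  linarith

lemma concaveOn_perspective_rpow {p : ℝ} (hp : 0 < p)
    (hφp : ConcaveOn ℝ (Ici 0) fun t : ℝ => φ (t ^ (1 / p))) {v : ℝ} (hv : 0 < v) :
    ConcaveOn ℝ (Ici 0) fun c : ℝ => φ (c ^ (1 / p) / v) * v := by
  have key : ∀ c : ℝ, 0 ≤ c → c ^ (1 / p) / v = (c / v ^ p) ^ (1 / p) := by
    intro c hc
    rw [Real.div_rpow hc (by positivity), ← Real.rpow_mul hv.le, mul_one_div_cancel hp.ne',
      Real.rpow_one]
  refine ⟨convex_Ici 0, fun x hx y hy α β hα hβ hαβ => ?_⟩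
  have hx0 : 0 ≤ x := hx
  have hy0 : 0 ≤ y := hy
  have := hφp.2 (x := x / v ^ p) (y := y / v ^ p) (mem_Ici.2 (by positivity))
    (mem_Ici.2 (by positivity)) hα hβ hαβ
  simp only [smul_eq_mul] at this ⊢
  rw [key x hx0, key y hy0, key _ (by positivity), add_div, mul_div_assoc, mul_div_assoc]
  nlinarith

/-- The right derivative in `c` of `c ↦ φ(c^q/v)·v`, for extended-real `c`, written as a
supremum of slopes. -/
def slopeKern (φ : ℝ → ℝ) (q : ℝ) (c : ℝ≥0∞) (v : ℝ) : ℝ≥0∞ :=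
  if c = ∞ then 0 else if v = 0 then ∞ else
    ⨆ b : ℝ, ⨆ _ : c.toReal < b,
      ENNReal.ofReal (slope (fun x => φ (x ^ q / v) * v) c.toReal b)

lemma IsOrliczFn.slopeKern_anti (hφ : IsOrliczFn φ) {p : ℝ} (hp : 0 < p)
    (hφp : ConcaveOn ℝ (Ici 0) fun t : ℝ => φ (t ^ (1 / p))) {c c' : ℝ≥0∞} {v v' : ℝ}
    (hv : 0 ≤ v) (hc : c ≤ c') (h : v ≤ v') :
    slopeKern φ (1 / p) c' v' ≤ slopeKern φ (1 / p) c v := by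
  unfold slopeKern
  by_cases h1 : c' = ∞
  · simp [h1]
  have h2 : c ≠ ∞ := ne_top_of_le_ne_top h1 hc
  rcases hv.eq_or_lt with rfl | hv
  · simp [h2]
  rw [if_neg h1, if_neg h2, if_neg hv.ne', if_neg (hv.trans_le h).ne']
  have hcc : c.toReal ≤ c'.toReal := ENNReal.toReal_mono h1 hc
  have hc0 : 0 ≤ c.toReal := ENNReal.toReal_nonneg
  refine iSup₂_le fun b hb => le_iSup₂_of_le b (hcc.trans_lt hb) (ENNReal.ofReal_le_ofReal ?_)
  have hb0 : 0 < b := hc0.trans_lt (hcc.trans_lt hb)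
  calc slope (fun x => φ (x ^ (1 / p) / v') * v') c'.toReal b
      ≤ slope (fun x => φ (x ^ (1 / p) / v) * v) c'.toReal b := by
        rw [slope_def_field, slope_def_field, div_le_div_iff_of_pos_right (sub_pos.2 hb)]
        exact hφ.perspective_sub_anti hv h (by positivity)
          (Real.rpow_lt_rpow ENNReal.toReal_nonneg hb (by positivity))
    _ ≤ _ := by
        rw [slope_comm _ c'.toReal, slope_comm _ c.toReal]
        exact (concaveOn_perspective_rpow hp hφp hv).slope_anti (mem_Ici.2 hb0.le)
          ⟨hc0, (hcc.trans_lt hb).ne⟩ ⟨hc0.trans hcc, hb.ne⟩ hcc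

lemma otermE_ofReal_rpow {q c v : ℝ} (hq : 0 < q) (hc : 0 ≤ c) (hv : 0 < v) :
    otermE φ (ENNReal.ofReal c ^ q) v = ENNReal.ofReal (φ (c ^ q / v) * v) := by
  rw [ENNReal.ofReal_rpow_of_nonneg hc hq.le, otermE, if_neg ENNReal.ofReal_ne_top, oterm,
    if_neg hv.ne', ENNReal.toReal_ofReal (by positivity)]

/-- Supporting line inequality for `c ↦ φ(c^{1/p}/v)·v`. -/
lemma IsOrliczFn.otermE_add_le (hφ : IsOrliczFn φ) {p : ℝ} (hp : 0 < p)
    (hφp : ConcaveOn ℝ (Ici 0) fun t : ℝ => φ (t ^ (1 / p))) {c d : ℝ≥0∞} {v : ℝ}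
    (hv : 0 ≤ v) (hcd : c = 0 → d = 0) :
    otermE φ (d ^ (1 / p)) v + slopeKern φ (1 / p) c v * c ≤
      otermE φ (c ^ (1 / p)) v + slopeKern φ (1 / p) c v * d := by
  have hq : 0 < 1 / p := by positivity
  by_cases hct : c = ∞
  · simp [hct, otermE, ENNReal.top_rpow_of_pos (inv_pos.2 hp)]
  by_cases hc0 : c = 0
  · rw [hcd hc0, hc0]
  rcases hv.eq_or_lt with rfl | hv
  · have : otermE φ (c ^ (1 / p)) 0 = ∞ := by
      have h1 : (c ^ (1 / p)).toReal ≠ 0 := by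
        rw [← ENNReal.toReal_rpow]
        exact (Real.rpow_pos_of_pos (ENNReal.toReal_pos hc0 hct) _).ne'
      simp only [otermE, oterm, h1, if_true, if_false, ite_self]
    rw [this, top_add]
    exact le_top
  set G : ℝ → ℝ := fun x => φ (x ^ (1 / p) / v) * v with hG
  have hconc : ConcaveOn ℝ (Ici 0) G := concaveOn_perspective_rpow hp hφp hv
  have hGmono : StrictMonoOn G (Ici 0) := by
    intro x hx y hy hxy
    have hx0 : 0 ≤ x := hx
    have hy0 : 0 ≤ y := hy
    refine mul_lt_mul_of_pos_right (hφ.2.1 (mem_Ici.2 (by positivity)) (mem_Ici.2 (by positivity))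
      ?_) hv
    have := Real.rpow_lt_rpow hx0 hxy hq
    gcongr
  have hG0 : G 0 = 0 := by simp [hG, Real.zero_rpow (inv_pos.2 hp).ne', hφ.2.2]
  obtain ⟨x, hx, rfl⟩ : ∃ x : ℝ, 0 < x ∧ c = ENNReal.ofReal x :=
    ⟨c.toReal, ENNReal.toReal_pos hc0 hct, (ENNReal.ofReal_toReal hct).symm⟩
  have hK : slopeKern φ (1 / p) (ENNReal.ofReal x) v =
      ⨆ b : ℝ, ⨆ _ : x < b, ENNReal.ofReal (slope G x b) := by
    rw [slopeKern, if_neg hct, if_neg hv.ne', ENNReal.toReal_ofReal hx.le]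
  set K := slopeKern φ (1 / p) (ENNReal.ofReal x) v
  have hlow : ∀ b, x < b → ENNReal.ofReal (slope G x b) ≤ K := fun b hb =>
    hK ▸ le_iSup₂_of_le b hb le_rfl
  have hup : ∀ y, 0 ≤ y → y < x → K ≤ ENNReal.ofReal (slope G y x) := by
    intro y hy hyx
    rw [hK]
    refine iSup₂_le fun b hb => ENNReal.ofReal_le_ofReal ?_
    rw [slope_comm G y]
    exact hconc.slope_anti (mem_Ici.2 hx.le) ⟨hy, hyx.ne⟩ ⟨hx.le.trans hb.le, hb.ne'⟩
      (hyx.le.trans hb.le)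
  by_cases hdt : d = ∞
  · have hpos : K ≠ 0 := by
      refine ne_bot_of_le_ne_bot ?_ (hlow (x + 1) (by linarith))
      have := hGmono (mem_Ici.2 hx.le) (mem_Ici.2 (by linarith : (0:ℝ) ≤ x + 1)) (by linarith)
      simpa [slope_def_field] using this
    simp [hdt, ENNReal.mul_top hpos]
  obtain ⟨y, hy, rfl⟩ : ∃ y : ℝ, 0 ≤ y ∧ d = ENNReal.ofReal y :=
    ⟨d.toReal, ENNReal.toReal_nonneg, (ENNReal.ofReal_toReal hdt).symm⟩
  have hKt : K ≠ ∞ := ne_top_of_le_ne_top ENNReal.ofReal_ne_top (hup 0 le_rfl hx)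
  obtain ⟨k, hk, hkK⟩ : ∃ k : ℝ, 0 ≤ k ∧ K = ENNReal.ofReal k :=
    ⟨K.toReal, ENNReal.toReal_nonneg, (ENNReal.ofReal_toReal hKt).symm⟩
  have hGnn : ∀ z, 0 ≤ z → 0 ≤ G z := fun z hz =>
    hG0 ▸ hGmono.monotoneOn (mem_Ici.2 le_rfl) (mem_Ici.2 hz) hz
  rw [otermE_ofReal_rpow hq hy hv, otermE_ofReal_rpow hq hx.le hv, hkK,
    ← ENNReal.ofReal_mul hk, ← ENNReal.ofReal_mul hk,
    ← ENNReal.ofReal_add (hGnn y hy) (by positivity),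
    ← ENNReal.ofReal_add (hGnn x hx.le) (by positivity)]
  refine ENNReal.ofReal_le_ofReal ?_
  rcases lt_trichotomy x y with h | h | h
  · have := hlow y h
    rw [hkK, ENNReal.ofReal_le_ofReal_iff hk, slope_def_field, div_le_iff₀ (sub_pos.2 h)] at this
    linarith
  · rw [h]
  · have := hup y hy h
    have hnn : 0 ≤ slope G y x := by
      rw [slope_def_field]
      exact div_nonneg (sub_nonneg.2 (hGmono.monotoneOn hy hx.le h.le)) (sub_nonneg.2 h.le)
    rw [hkK, ENNReal.ofReal_le_ofReal_iff hnn, slope_def_field, le_div_iff₀ (sub_pos.2 h)] at this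
    linarith

end Kernel

section Tail

/-- Layer cake formula for `[0,∞]`-valued functions. -/
lemma setLIntegral_eq_lintegral_volume_lt (S : Set ℝ) {F : ℝ → ℝ≥0∞} (hF : Measurable F) :
    ∫⁻ t in S, F t = ∫⁻ s in Ioi (0 : ℝ), volume (S ∩ {t | ENNReal.ofReal s < F t}) := by
  have := setLIntegral_Ioa'_swap S F hF (fun _ _ => 1) measurable_const
  simpa [volume_Ioa'] using this

lemma exists_measurableSet_between {A B : Set ℝ} (hA : MeasurableSet A) (hB : MeasurableSet B)
    (hAB : A ⊆ B) (hB0 : B ⊆ Ioi 0) {x : ℝ≥0∞} (hAx : volume A ≤ x) (hxB : x ≤ volume B)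
    (hfin : volume B ≠ ∞) :
    ∃ E, MeasurableSet E ∧ A ⊆ E ∧ E ⊆ B ∧ volume E = x := by
  rcases hxB.eq_or_lt with rfl | hxB
  · exact ⟨B, hB, hAB, Subset.rfl, rfl⟩
  let U : ℝ → Set ℝ := fun y => A ∪ (B ∩ Iic y)
  have hUB : ∀ y, U y ⊆ B := fun y => union_subset hAB inter_subset_left
  have hUfin : ∀ y, volume (U y) ≠ ∞ := fun y => measure_ne_top_of_subset (hUB y) hfin
  have hmono : Monotone U := fun y z h => union_subset_union_right _
    (inter_subset_inter_right _ (Iic_subset_Iic.2 h))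
  have hUnion : B = ⋃ n : ℕ, U n := by
    refine Subset.antisymm (fun t ht => ?_) (iUnion_subset fun n => hUB n)
    obtain ⟨n, hn⟩ := exists_nat_ge t
    exact mem_iUnion.2 ⟨n, Or.inr ⟨ht, hn⟩⟩
  obtain ⟨n, hn⟩ : ∃ n : ℕ, x < volume (U n) := by
    have hmonoN : Monotone fun n : ℕ => U n := hmono.comp Nat.mono_cast
    rw [hUnion, hmonoN.measure_iUnion] at hxB
    exact lt_iSup_iff.1 hxB
  have hx : x ≠ ∞ := hn.ne_top
  have hcont : Continuous fun y => volume.real (U y) := by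
    refine (LipschitzWith.of_le_add fun y z => ?_).continuous
    have hsub : U y ⊆ U z ∪ Ioc z y := by
      rintro t (ht | ⟨ht, hty⟩)
      · exact Or.inl (Or.inl ht)
      · rcases le_or_gt t z with h | h
        · exact Or.inl (Or.inr ⟨ht, h⟩)
        · exact Or.inr ⟨h, hty⟩
    calc volume.real (U y) ≤ volume.real (U z ∪ Ioc z y) :=
          measureReal_mono hsub (measure_union_ne_top (hUfin z) (by simp))
      _ ≤ volume.real (U z) + volume.real (Ioc z y) := measureReal_union_le _ _
      _ ≤ _ := by
        gcongr
        rw [Real.volume_real_Ioc, Real.dist_eq]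
        exact max_le (le_abs_self _) (abs_nonneg _)
  have h0 : U 0 = A := by
    refine Subset.antisymm (union_subset Subset.rfl fun t ht => ?_) subset_union_left
    exact absurd (mem_Ioi.1 (hB0 ht.1)) (not_lt.2 (mem_Iic.1 ht.2))
  obtain ⟨y, -, hy⟩ := intermediate_value_Icc (Nat.cast_nonneg n) hcont.continuousOn
    (show x.toReal ∈ Icc (volume.real (U 0)) (volume.real (U n)) from
      ⟨h0 ▸ ENNReal.toReal_mono hx hAx, ENNReal.toReal_mono (hUfin n) hn.le⟩)
  exact ⟨U y, hA.union (hB.inter measurableSet_Iic), subset_union_left, hUB y,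
    (ENNReal.toReal_eq_toReal_iff' (hUfin y) hx).1 hy⟩

lemma tendsto_distr_zero {a : ℝ≥0∞} {h : ℝ → ℝ} (hh : Measurable h)
    (hfin : ∀ s, 0 < s → distr a h s ≠ ∞) :
    Tendsto (fun n : ℕ => distr a h n) atTop (𝓝 0) := by
  have h1 := tendsto_measure_iInter_atTop (μ := volume)
    (s := fun n : ℕ => {t ∈ Ioa' a | (n : ℝ) < |h t|})
    (fun n => ((measurableSet_Ioa' a).inter
      (measurableSet_lt measurable_const hh.abs)).nullMeasurableSet)
    (fun m n hmn t ht => ⟨ht.1, lt_of_le_of_lt (Nat.cast_le.2 hmn) ht.2⟩)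
    ⟨1, by simpa [distr] using hfin 1 one_pos⟩
  have h2 : ⋂ n : ℕ, {t ∈ Ioa' a | (n : ℝ) < |h t|} = ∅ := by
    refine eq_empty_of_forall_notMem fun t ht => ?_
    obtain ⟨n, hn⟩ := exists_nat_ge |h t|
    exact not_lt.2 hn (mem_iInter.1 ht n).2
  rw [h2, measure_empty] at h1
  exact h1

/-- A set of measure at most `x` on which `h` is largest. -/
lemma exists_measurableSet_distr_diff_le {a : ℝ≥0∞} {h : ℝ → ℝ} (hh : Measurable h)
    (hfin : ∀ s, 0 < s → distr a h s ≠ ∞) (x : ℝ≥0∞) :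
    ∃ E, MeasurableSet E ∧ volume E ≤ x ∧
      ∀ s, 0 < s → volume ({t ∈ Ioa' a | s < |h t|} \ E) ≤ distr a h s - x := by
  have hm : ∀ s, MeasurableSet {t ∈ Ioa' a | s < |h t|} := fun s =>
    (measurableSet_Ioa' a).inter (measurableSet_lt measurable_const hh.abs)
  by_cases hx : x = ∞
  · exact ⟨univ, MeasurableSet.univ, by simp [hx], by simp⟩
  by_cases hx0 : x = 0
  · exact ⟨∅, MeasurableSet.empty, by simp, by simp [hx0, distr]⟩
  obtain ⟨t, ht, rfl⟩ : ∃ t : ℝ, 0 < t ∧ x = ENNReal.ofReal t :=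
    ⟨x.toReal, ENNReal.toReal_pos hx0 hx, (ENNReal.ofReal_toReal hx).symm⟩
  have hlt : decRe a h t < ∞ := by
    obtain ⟨n, hn⟩ := ((tendsto_distr_zero hh hfin).eventually_le_const
      (ENNReal.ofReal_pos.2 ht)).exists
    exact ((decRe_le_iff n.cast_nonneg).2 hn).trans_lt ENNReal.ofReal_lt_top
  obtain ⟨l, hl, hdl⟩ : ∃ l : ℝ, 0 ≤ l ∧ decRe a h t = ENNReal.ofReal l :=
    ⟨_, ENNReal.toReal_nonneg, (ENNReal.ofReal_toReal hlt.ne).symm⟩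
  have hle : distr a h l ≤ ENNReal.ofReal t := (decRe_le_iff hl).1 hdl.le
  have hgt : ∀ s, 0 ≤ s → s < l → ENNReal.ofReal t < distr a h s := fun s hs hsl =>
    (ofReal_lt_decRe_iff hs).1 (hdl ▸ (ENNReal.ofReal_lt_ofReal_iff (hs.trans_lt hsl)).2 hsl)
  have hsub : ∀ {s s'}, s ≤ s' → {t ∈ Ioa' a | s' < |h t|} ⊆ {t ∈ Ioa' a | s < |h t|} :=
    fun hs _ ht => ⟨ht.1, hs.trans_lt ht.2⟩
  rcases hl.eq_or_lt with rfl | hl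
  · refine ⟨_, hm 0, hle, fun s hs => ?_⟩
    rw [sdiff_eq_empty.2 (hsub hs.le)]
    simp
  have hBm : MeasurableSet {t ∈ Ioa' a | l ≤ |h t|} :=
    (measurableSet_Ioa' a).inter (measurableSet_le measurable_const hh.abs)
  have hBs : ∀ s, s < l → {t ∈ Ioa' a | l ≤ |h t|} ⊆ {t ∈ Ioa' a | s < |h t|} :=
    fun s hs t ht => ⟨ht.1, hs.trans_le ht.2⟩
  have hBfin : volume {t ∈ Ioa' a | l ≤ |h t|} ≠ ∞ :=
    measure_ne_top_of_subset (hBs (l / 2) (by linarith)) (hfin _ (by linarith))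
  have hxB : ENNReal.ofReal t ≤ volume {t ∈ Ioa' a | l ≤ |h t|} := by
    obtain ⟨u, hu, hul, hutend⟩ := exists_seq_strictMono_tendsto' (half_lt_self hl)
    have h1 := tendsto_measure_iInter_atTop (μ := volume)
      (s := fun n : ℕ => {t ∈ Ioa' a | u n < |h t|}) (fun n => (hm _).nullMeasurableSet)
      (fun m n hmn => hsub (hu.monotone hmn))
      ⟨0, hfin _ (lt_trans (by linarith) (hul 0).1)⟩
    have h2 : ⋂ n : ℕ, {t ∈ Ioa' a | u n < |h t|} ⊆ {t ∈ Ioa' a | l ≤ |h t|} := fun t ht =>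
      ⟨(mem_iInter.1 ht 0).1, le_of_tendsto' hutend fun n => (mem_iInter.1 ht n).2.le⟩
    refine (ge_of_tendsto' h1 fun n => ?_).trans (measure_mono h2)
    exact (hgt _ (by linarith [(hul n).1]) (hul n).2).le
  obtain ⟨E, hE, hAE, hEB, hEx⟩ := exists_measurableSet_between (hm l) hBm
    (fun t ht => ⟨ht.1, ht.2.le⟩) (fun t ht => ht.1.1) hle hxB hBfin
  refine ⟨E, hE, hEx.le, fun s hs => ?_⟩
  rcases lt_or_ge s l with hsl | hsl
  · rw [measure_sdiff (hEB.trans (hBs s hsl)) hE.nullMeasurableSet (hEx ▸ ENNReal.ofReal_ne_top),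
      hEx]
    rfl
  · rw [sdiff_eq_empty.2 ((hsub hsl).trans hAE)]
    simp

lemma volume_Ioa'_inter {a d : ℝ≥0∞} {J : Set ℝ} (hJ : MeasurableSet J)
    (hup : ∀ t ∈ Ioa' a, ∀ t' ∈ Ioa' a, t ≤ t' → t ∈ J → t' ∈ J) (hda : d ≤ a) (hd : d ≠ ∞) :
    volume (Ioa' d ∩ J) = d - volume (Ioa' a \ J) := by
  have heq : Ioa' d ∩ J = Ioa' d \ (Ioa' a \ J) := by
    ext t
    have := @Ioa'_mono _ _ hda t
    simp only [mem_inter_iff, Set.mem_sdiff]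
    tauto
  by_cases h : Ioa' d ⊆ Ioa' a \ J
  · rw [heq, sdiff_eq_empty.2 h, measure_empty, eq_comm, tsub_eq_zero_iff_le]
    exact (volume_Ioa' d).ge.trans (measure_mono h)
  · obtain ⟨t, ht, htJ⟩ : ∃ t ∈ Ioa' d, t ∈ J := by
      by_contra! hcon
      exact h fun t ht => ⟨Ioa'_mono hda ht, hcon t ht⟩
    have hsub : Ioa' a \ J ⊆ Ioa' d := fun u hu => by
      have hut : u ≤ t := by
        by_contra! hcon
        exact hu.2 (hup t (Ioa'_mono hda ht) u hu.1 hcon.le htJ)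
      exact ⟨hu.1.1, (ENNReal.ofReal_le_ofReal hut).trans_lt ht.2⟩
    rw [heq, measure_sdiff hsub ((measurableSet_Ioa' a).diff hJ).nullMeasurableSet
      (measure_ne_top_of_subset hsub (by rwa [volume_Ioa'])), volume_Ioa']

lemma setLIntegral_decRe {a : ℝ≥0∞} {J : Set ℝ} (hJ : MeasurableSet J)
    (hup : ∀ t ∈ Ioa' a, ∀ t' ∈ Ioa' a, t ≤ t' → t ∈ J → t' ∈ J) {f : ℝ → ℝ}
    (hfin : ∀ s, 0 < s → distr a f s ≠ ∞) :
    ∫⁻ t in Ioa' a ∩ J, decRe a f t =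
      ∫⁻ s in Ioi (0 : ℝ), (distr a f s - volume (Ioa' a \ J)) := by
  rw [setLIntegral_eq_lintegral_volume_lt _ (decRe_anti a f).measurable]
  refine setLIntegral_congr_fun measurableSet_Ioi fun s hs => ?_
  rw [← volume_Ioa'_inter hJ hup (distr_le a f s) (hfin s hs)]
  congr 1
  ext t
  simp only [Ioa', mem_inter_iff, mem_ofPred_eq, ofReal_lt_decRe_iff (le_of_lt hs)]
  have := distr_le a f s
  exact ⟨fun h => ⟨⟨h.1.1.1, h.2⟩, h.1.2⟩, fun h => ⟨⟨⟨h.1.1, h.1.2.trans_le this⟩, h.2⟩, h.1.2⟩⟩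

lemma setLIntegral_diff_ofReal {a : ℝ≥0∞} (E : Set ℝ) {f : ℝ → ℝ} (hf : Measurable f)
    (hf0 : ∀ t, 0 ≤ f t) :
    ∫⁻ t in Ioa' a \ E, ENNReal.ofReal (f t) =
      ∫⁻ s in Ioi (0 : ℝ), volume ({t ∈ Ioa' a | s < |f t|} \ E) := by
  rw [setLIntegral_eq_lintegral_volume_lt _ hf.ennreal_ofReal]
  refine setLIntegral_congr_fun measurableSet_Ioi fun s hs => ?_
  congr 1
  ext t
  simp only [mem_inter_iff, mem_ofPred_eq, Set.mem_sdiff, abs_of_nonneg (hf0 t),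
    ENNReal.ofReal_lt_ofReal_iff_of_nonneg (le_of_lt hs)]
  tauto

lemma setLIntegral_decRe_le {a : ℝ≥0∞} {J : Set ℝ} (hJ : MeasurableSet J)
    (hup : ∀ t ∈ Ioa' a, ∀ t' ∈ Ioa' a, t ≤ t' → t ∈ J → t' ∈ J) {f : ℝ → ℝ}
    (hf : Measurable f) (hf0 : ∀ t, 0 ≤ f t) (hfin : ∀ s, 0 < s → distr a f s ≠ ∞) {E : Set ℝ}
    (hEx : volume E ≤ volume (Ioa' a \ J)) :
    ∫⁻ t in Ioa' a ∩ J, decRe a f t ≤ ∫⁻ t in Ioa' a \ E, ENNReal.ofReal (f t) := by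
  rw [setLIntegral_decRe hJ hup hfin, setLIntegral_diff_ofReal E hf hf0]
  refine lintegral_mono fun s => ?_
  exact (tsub_le_tsub_left hEx _).trans le_measure_sdiff

/-- Concavity of the tail integrals of the decreasing rearrangement. -/
lemma setLIntegral_decRe_concave {a : ℝ≥0∞} {J : Set ℝ} (hJ : MeasurableSet J)
    (hup : ∀ t ∈ Ioa' a, ∀ t' ∈ Ioa' a, t ≤ t' → t ∈ J → t' ∈ J) {f g : ℝ → ℝ}
    (hf : Measurable f) (hg : Measurable g) (hf0 : ∀ t, 0 ≤ f t) (hg0 : ∀ t, 0 ≤ g t)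
    {α β : ℝ} (hα : 0 ≤ α) (hβ : 0 ≤ β)
    (hffin : ∀ s, 0 < s → distr a f s ≠ ∞) (hgfin : ∀ s, 0 < s → distr a g s ≠ ∞)
    (hfin : ∀ s, 0 < s → distr a (fun t => α * f t + β * g t) s ≠ ∞) :
    (ENNReal.ofReal α * ∫⁻ t in Ioa' a ∩ J, decRe a f t) +
        ENNReal.ofReal β * ∫⁻ t in Ioa' a ∩ J, decRe a g t ≤
      ∫⁻ t in Ioa' a ∩ J, decRe a (fun t => α * f t + β * g t) t := by
  have hh : Measurable fun t => α * f t + β * g t := (hf.const_mul α).add (hg.const_mul β)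
  have hh0 : ∀ t, 0 ≤ α * f t + β * g t := fun t =>
    add_nonneg (mul_nonneg hα (hf0 t)) (mul_nonneg hβ (hg0 t))
  obtain ⟨E, hE, hEx, hEs⟩ := exists_measurableSet_distr_diff_le hh hfin (volume (Ioa' a \ J))
  calc _ ≤ (ENNReal.ofReal α * ∫⁻ t in Ioa' a \ E, ENNReal.ofReal (f t)) +
        ENNReal.ofReal β * ∫⁻ t in Ioa' a \ E, ENNReal.ofReal (g t) := by
        exact add_le_add
          (mul_le_mul' le_rfl (setLIntegral_decRe_le hJ hup hf hf0 hffin hEx))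
          (mul_le_mul' le_rfl (setLIntegral_decRe_le hJ hup hg hg0 hgfin hEx))
    _ = ∫⁻ t in Ioa' a \ E, ENNReal.ofReal (α * f t + β * g t) := by
        rw [← lintegral_const_mul _ hf.ennreal_ofReal, ← lintegral_const_mul _ hg.ennreal_ofReal,
          ← lintegral_add_left (hf.ennreal_ofReal.const_mul _)]
        refine lintegral_congr fun t => ?_
        rw [ENNReal.ofReal_add (mul_nonneg hα (hf0 t)) (mul_nonneg hβ (hg0 t)),
          ENNReal.ofReal_mul hα, ENNReal.ofReal_mul hβ]
    _ ≤ _ := by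
        rw [setLIntegral_decRe hJ hup hfin, setLIntegral_diff_ofReal E hh hh0]
        exact setLIntegral_mono' measurableSet_Ioi hEs

/-- Concavity of `f ↦ ∫ ρ f*` for increasing `ρ`. -/
lemma setLIntegral_mul_decRe_concave {a : ℝ≥0∞} {ρ : ℝ → ℝ≥0∞} (hρ : Monotone ρ) {f g : ℝ → ℝ}
    (hf : Measurable f) (hg : Measurable g) (hf0 : ∀ t, 0 ≤ f t) (hg0 : ∀ t, 0 ≤ g t)
    {α β : ℝ} (hα : 0 ≤ α) (hβ : 0 ≤ β)
    (hffin : ∀ s, 0 < s → distr a f s ≠ ∞) (hgfin : ∀ s, 0 < s → distr a g s ≠ ∞)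
    (hfin : ∀ s, 0 < s → distr a (fun t => α * f t + β * g t) s ≠ ∞) :
    (ENNReal.ofReal α * ∫⁻ t in Ioa' a, ρ t * decRe a f t) +
        ENNReal.ofReal β * ∫⁻ t in Ioa' a, ρ t * decRe a g t ≤
      ∫⁻ t in Ioa' a, ρ t * decRe a (fun t => α * f t + β * g t) t := by
  have key : ∀ u : ℝ → ℝ, ∫⁻ t in Ioa' a, ρ t * decRe a u t =
      ∫⁻ r in Ioi (0 : ℝ), ∫⁻ t in Ioa' a ∩ {t | ENNReal.ofReal r < ρ t}, decRe a u t := by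
    intro u
    rw [← setLIntegral_Ioa'_swap (Ioa' a) ρ hρ.measurable (fun _ t => decRe a u t)
      ((decRe_anti a u).measurable.comp measurable_snd)]
    simp [volume_Ioa', mul_comm]
  simp only [key]
  rw [← lintegral_const_mul' _ _ ENNReal.ofReal_ne_top,
    ← lintegral_const_mul' _ _ ENNReal.ofReal_ne_top]
  refine (le_lintegral_add _ _).trans (lintegral_mono fun r => ?_)
  exact setLIntegral_decRe_concave (measurableSet_lt measurable_const hρ.measurable)
    (fun t _ t' _ htt' ht => lt_of_lt_of_le ht (hρ htt')) hf hg hf0 hg0 hα hβ hffin hgfin hfin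

end Tail

section Concavity

lemma distr_rpow {a : ℝ≥0∞} {f : ℝ → ℝ} (hf0 : ∀ t, 0 ≤ f t) {q s : ℝ} (hq : 0 < q)
    (hs : 0 ≤ s) : distr a (fun t => f t ^ q) (s ^ q) = distr a f s := by
  unfold distr
  congr 1
  ext t
  simp only [mem_ofPred_eq, abs_of_nonneg (Real.rpow_nonneg (hf0 t) q), abs_of_nonneg (hf0 t),
    Real.rpow_lt_rpow_iff hs (hf0 t) hq]

lemma decRe_rpow {a : ℝ≥0∞} {f : ℝ → ℝ} (hf0 : ∀ t, 0 ≤ f t) {q : ℝ} (hq : 0 < q) (t : ℝ) :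
    decRe a (fun t => f t ^ q) t = decRe a f t ^ q := by
  have key : ∀ s : ℝ, 0 ≤ s →
      (decRe a (fun t => f t ^ q) t ≤ ENNReal.ofReal s ↔
        decRe a f t ^ q ≤ ENNReal.ofReal s) := by
    intro s hs
    obtain ⟨r, hr, rfl⟩ : ∃ r : ℝ, 0 ≤ r ∧ s = r ^ q :=
      ⟨s ^ q⁻¹, by positivity, (Real.rpow_inv_rpow hs hq.ne').symm⟩
    rw [decRe_le_iff hs, distr_rpow hf0 hq hr, ← decRe_le_iff hr,
      ← ENNReal.ofReal_rpow_of_nonneg hr hq.le, ENNReal.rpow_le_rpow_iff hq]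
  refine eq_of_forall_ge_iff fun c => ?_
  by_cases hc : c = ∞
  · simp [hc]
  · rw [← ENNReal.ofReal_toReal hc]
    exact key _ ENNReal.toReal_nonneg

variable {a : ℝ≥0∞} {φ w : ℝ → ℝ}

lemma IsOrliczFn.distr_ne_top (hφ : IsOrliczFn φ) (hw_nonneg : ∀ t ∈ Ioa' a, 0 ≤ w t)
    (hw_dec : ∀ s ∈ Ioa' a, ∀ t ∈ Ioa' a, s ≤ t → w t ≤ w s) {f : ℝ → ℝ}
    (hf : Mmod a φ w f ≠ ∞) {s : ℝ} (hs : 0 < s) : distr a f s ≠ ∞ := by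
  intro htop
  have ha : a = ∞ := top_le_iff.1 (htop ▸ distr_le a f s)
  have hmem : ∀ t : ℝ, 0 < t → t ∈ Ioa' a := fun t ht => by simpa [ha, Ioa'_top] using ht
  refine hf (top_le_iff.1 ?_)
  calc ∞ = ∫⁻ _ in Ioi (1 : ℝ), otermE φ (ENNReal.ofReal s) (w 1) := by
        rw [setLIntegral_const, Real.volume_Ioi, ENNReal.mul_top]
        exact hφ.otermE_pos (hw_nonneg 1 (hmem 1 one_pos)) (by simpa using hs)
    _ ≤ ∫⁻ t in Ioi (1 : ℝ), otermE φ (decRe a f t) (w t) := by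
        refine setLIntegral_mono' measurableSet_Ioi fun t ht => ?_
        have ht1 : (1 : ℝ) < t := ht
        have ht0 := hmem t (one_pos.trans ht1)
        refine hφ.otermE_mono (hw_nonneg t ht0) ?_ (hw_dec 1 (hmem 1 one_pos) t ht0 ht1.le)
        exact ((ofReal_lt_decRe_iff hs.le).2 (htop ▸ ENNReal.ofReal_lt_top)).le
    _ ≤ _ := lintegral_mono_set fun t ht => hmem t (one_pos.trans ht)

lemma distr_le_distr_of_mul_le {f h : ℝ → ℝ} (hf0 : ∀ t, 0 ≤ f t) {c : ℝ} (hc : 0 < c)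
    (hfh : ∀ t, c * f t ≤ h t) (s : ℝ) : distr a f s ≤ distr a h (c * s) := by
  refine measure_mono fun t ht => ⟨ht.1, ?_⟩
  have h2 := ht.2
  rw [abs_of_nonneg (hf0 t)] at h2
  exact (mul_lt_mul_of_pos_left h2 hc).trans_le ((hfh t).trans (le_abs_self _))

lemma decRe_eq_zero_of_mul_le {f h : ℝ → ℝ} (hf0 : ∀ t, 0 ≤ f t) {c : ℝ} (hc : 0 < c)
    (hfh : ∀ t, c * f t ≤ h t) {t : ℝ} (ht : decRe a h t = 0) : decRe a f t = 0 := by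
  have h0 : ∀ u, decRe a u t = 0 ↔ distr a u 0 ≤ ENNReal.ofReal t := fun u => by
    rw [← decRe_le_iff le_rfl, ENNReal.ofReal_zero, nonpos_iff_eq_zero]
  rw [h0] at ht ⊢
  have := distr_le_distr_of_mul_le (a := a) hf0 hc hfh 0
  rw [mul_zero] at this
  exact this.trans ht

lemma IsOrliczFn.Mmod_rpow_concave (hφ : IsOrliczFn φ)
    (hw_nonneg : ∀ t ∈ Ioa' a, 0 ≤ w t)
    (hw_dec : ∀ s ∈ Ioa' a, ∀ t ∈ Ioa' a, s ≤ t → w t ≤ w s) {p : ℝ} (hp : 0 < p)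
    (hφp : ConcaveOn ℝ (Ici 0) fun t : ℝ => φ (t ^ (1 / p))) {f g : ℝ → ℝ}
    (hf : Measurable f) (hg : Measurable g) (hf0 : ∀ t, 0 ≤ f t) (hg0 : ∀ t, 0 ≤ g t)
    {α β : ℝ} (hα : 0 < α) (hβ : 0 < β) (hαβ : α + β = 1) :
    (ENNReal.ofReal α * Mmod a φ w fun t => f t ^ (1 / p)) +
        (ENNReal.ofReal β * Mmod a φ w fun t => g t ^ (1 / p)) ≤
      Mmod a φ w fun t => (α * f t + β * g t) ^ (1 / p) := by
  have hq : 0 < 1 / p := by positivity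
  set h : ℝ → ℝ := fun t => α * f t + β * g t
  have hh0 : ∀ t, 0 ≤ h t := fun t =>
    add_nonneg (mul_nonneg hα.le (hf0 t)) (mul_nonneg hβ.le (hg0 t))
  have hfh : ∀ t, α * f t ≤ h t := fun t => le_add_of_nonneg_right (mul_nonneg hβ.le (hg0 t))
  have hgh : ∀ t, β * g t ≤ h t := fun t => le_add_of_nonneg_left (mul_nonneg hα.le (hf0 t))
  by_cases hM : (Mmod a φ w fun t => h t ^ (1 / p)) = ∞
  · exact hM ▸ le_top
  have hhfin : ∀ s, 0 < s → distr a h s ≠ ∞ := fun s hs => by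
    rw [← distr_rpow hh0 hq hs.le]
    exact hφ.distr_ne_top hw_nonneg hw_dec hM (by positivity)
  have hffin : ∀ s, 0 < s → distr a f s ≠ ∞ := fun s hs =>
    ne_top_of_le_ne_top (hhfin _ (mul_pos hα hs)) (distr_le_distr_of_mul_le hf0 hα hfh s)
  have hgfin : ∀ s, 0 < s → distr a g s ≠ ∞ := fun s hs =>
    ne_top_of_le_ne_top (hhfin _ (mul_pos hβ hs)) (distr_le_distr_of_mul_le hg0 hβ hgh s)
  have hmono : MonotoneOn (fun t => slopeKern φ (1 / p) (decRe a h t) (w t)) (Ioa' a) :=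
    fun s hs t ht hst => hφ.slopeKern_anti hp hφp (hw_nonneg t ht) (decRe_anti a h hst)
      (hw_dec s hs t ht hst)
  obtain ⟨ρ, hρ, hρeq⟩ := hmono.exists_monotone_extension (OrderBot.bddBelow _)
    (OrderTop.bddAbove _)
  have hρD : ∀ D : ℝ → ℝ≥0∞, Measurable D → Measurable fun t => ρ t * D t := fun D hD =>
    hρ.measurable.mul hD
  have supp : ∀ D : ℝ → ℝ≥0∞, Measurable D → (∀ t, decRe a h t = 0 → D t = 0) →
      (∫⁻ t in Ioa' a, otermE φ (D t ^ (1 / p)) (w t)) + ∫⁻ t in Ioa' a, ρ t * decRe a h t ≤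
        (Mmod a φ w fun t => h t ^ (1 / p)) + ∫⁻ t in Ioa' a, ρ t * D t := by
    intro D hD hD0
    rw [Mmod, ← lintegral_add_right _ (hρD _ (decRe_anti a h).measurable),
      ← lintegral_add_right _ (hρD D hD)]
    refine setLIntegral_mono' (measurableSet_Ioa' a) fun t ht => ?_
    rw [decRe_rpow hh0 hq, ← hρeq ht]
    exact hφ.otermE_add_le hp hφp (hw_nonneg t ht) (hD0 t)
  have hL : ∫⁻ t in Ioa' a, ρ t * decRe a h t ≠ ∞ := by
    have := supp (fun _ => 0) measurable_const fun _ _ => rfl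
    simp only [mul_zero, lintegral_zero, add_zero] at this
    exact ne_top_of_le_ne_top hM (le_add_self.trans this)
  have hfs := supp (decRe a f) (decRe_anti a f).measurable fun t =>
    decRe_eq_zero_of_mul_le hf0 hα hfh
  have hgs := supp (decRe a g) (decRe_anti a g).measurable fun t =>
    decRe_eq_zero_of_mul_le hg0 hβ hgh
  have hconc := setLIntegral_mul_decRe_concave hρ hf hg hf0 hg0 hα.le hβ.le hffin hgfin hhfin
  have hMf : (Mmod a φ w fun t => f t ^ (1 / p)) =
      ∫⁻ t in Ioa' a, otermE φ (decRe a f t ^ (1 / p)) (w t) := by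
    simp only [Mmod, decRe_rpow hf0 hq]
  have hMg : (Mmod a φ w fun t => g t ^ (1 / p)) =
      ∫⁻ t in Ioa' a, otermE φ (decRe a g t ^ (1 / p)) (w t) := by
    simp only [Mmod, decRe_rpow hg0 hq]
  rw [← hMf] at hfs
  rw [← hMg] at hgs
  have hsum : ENNReal.ofReal α + ENNReal.ofReal β = 1 := by
    rw [← ENNReal.ofReal_add hα.le hβ.le, hαβ, ENNReal.ofReal_one]
  refine ENNReal.le_of_add_le_add_right hL ?_
  refine le_trans ?_ (add_le_add le_rfl hconc)
  generalize (∫⁻ t in Ioa' a, ρ t * decRe a h t) = L at *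
  generalize (∫⁻ t in Ioa' a, ρ t * decRe a f t) = Lf at *
  generalize (∫⁻ t in Ioa' a, ρ t * decRe a g t) = Lg at *
  generalize (Mmod a φ w fun t => f t ^ (1 / p)) = Mf at *
  generalize (Mmod a φ w fun t => g t ^ (1 / p)) = Mg at *
  generalize (Mmod a φ w fun t => h t ^ (1 / p)) = Mh at *
  calc ENNReal.ofReal α * Mf + ENNReal.ofReal β * Mg + L
      = ENNReal.ofReal α * Mf + ENNReal.ofReal β * Mg +
          (ENNReal.ofReal α + ENNReal.ofReal β) * L := by rw [hsum, one_mul]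
    _ = ENNReal.ofReal α * (Mf + L) + ENNReal.ofReal β * (Mg + L) := by ring
    _ ≤ ENNReal.ofReal α * (Mh + Lf) + ENNReal.ofReal β * (Mh + Lg) :=
        add_le_add (mul_le_mul' le_rfl hfs) (mul_le_mul' le_rfl hgs)
    _ = (ENNReal.ofReal α + ENNReal.ofReal β) * Mh +
          (ENNReal.ofReal α * Lf + ENNReal.ofReal β * Lg) := by ring
    _ = Mh + (ENNReal.ofReal α * Lf + ENNReal.ofReal β * Lg) := by rw [hsum, one_mul]

end Concavity

/-- (1) the modular `M` is disjointly superadditive; (2) if `φ` is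
`p`-concave for some `1 < p < ∞`, then so is the modular `M`, i.e. `f ↦ M(f^{1/p})` is
concave on nonnegative measurable functions. -/
theorem statement12 (a : ℝ≥0∞) (ha : 0 < a) (φ : ℝ → ℝ) (hφ : IsOrliczFn φ)
    (w : ℝ → ℝ) (hw_meas : Measurable w) (hw_nonneg : ∀ t ∈ Ioa' a, 0 ≤ w t)
    (hw_dec : ∀ s ∈ Ioa' a, ∀ t ∈ Ioa' a, s ≤ t → w t ≤ w s) :
    (∀ f g : ℝ → ℝ, Measurable f → Measurable g →
      (∀ t ∈ Ioa' a, f t = 0 ∨ g t = 0) →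
      Mmod a φ w f + Mmod a φ w g ≤ Mmod a φ w (fun t => f t + g t)) ∧
    (∀ p : ℝ, 1 < p →
      ConcaveOn ℝ (Set.Ici 0) (fun t : ℝ => φ (t ^ (1 / p))) →
      ∀ f g : ℝ → ℝ, Measurable f → Measurable g →
        (∀ t, 0 ≤ f t) → (∀ t, 0 ≤ g t) →
        ∀ θ : ℝ, 0 ≤ θ → θ ≤ 1 →
          ENNReal.ofReal θ * Mmod a φ w (fun t => f t ^ (1 / p)) +
              ENNReal.ofReal (1 - θ) * Mmod a φ w (fun t => g t ^ (1 / p)) ≤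
            Mmod a φ w (fun t => (θ * f t + (1 - θ) * g t) ^ (1 / p))) := by
  refine ⟨fun f g _ hg hfg => hφ.Mmod_add_le hw_meas hw_nonneg hw_dec hg hfg, ?_⟩
  intro p hp hφp f g hf hg hf0 hg0 θ hθ0 hθ1
  rcases hθ0.eq_or_lt with rfl | hθ0
  · simp
  rcases hθ1.eq_or_lt with rfl | hθ1
  · simp
  exact hφ.Mmod_rpow_concave hw_nonneg hw_dec (one_pos.trans hp) hφp hf hg hf0 hg0 hθ0
    (sub_pos.2 hθ1) (by ring)

end OrliczRearrangement

end
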